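/- The zeta polynomial P(T) of C has degree exactly n + 2 − d − d⊥ and satisfies P(1) = 1. -/

import Mathlib

open Finset Polynomial

noncomputable section

variable {F : Type*} [Field F] [Fintype F] {ι : Type*} [Fintype ι]

/-- Hamming weight of a vector. -/
def wt (x : ι → F) : ℕ := Set.ncard {i | x i ≠ 0}

/-- The dual code with respect to the standard bilinear form. -/
def dualCode (Γ : Submodule F (ι → F)) : Submodule F (ι → F) where
  carrier := {x | ∀ c ∈ Γ, ∑ i, x i * c i = 0}
  zero_mem' := by intro c hc; simp
  add_mem' := by
    intro a b ha hb c hc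
    simp [Pi.add_apply, add_mul, Finset.sum_add_distrib, ha c hc, hb c hc]
  smul_mem' := by
    intro r a ha c hc
    simp [Pi.smul_apply, smul_eq_mul, mul_assoc, ← Finset.mul_sum, ha c hc]

/-- Minimum distance: the least Hamming weight of a nonzero codeword. -/
def minDist (Γ : Submodule F (ι → F)) : ℕ := sInf {w | ∃ x ∈ Γ, x ≠ 0 ∧ wt x = w}

/-- Number of codewords of weight `i`. -/
def wtCount (Γ : Submodule F (ι → F)) (i : ℕ) : ℕ := Set.ncard {x | x ∈ Γ ∧ wt x = i}

/-- Vectors supported inside a set `S` of coordinates. -/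
def supportedOn (F : Type*) [Field F] {ι : Type*} (S : Finset ι) : Submodule F (ι → F) where
  carrier := {x | ∀ i ∉ S, x i = 0}
  zero_mem' := by intro i hi; rfl
  add_mem' := by intro a b ha hb i hi; simp [Pi.add_apply, ha i hi, hb i hi]
  smul_mem' := by intro r a ha i hi; simp [Pi.smul_apply, ha i hi]

/-- The rank function: dimension of the projection of the code to coordinates in `S`. -/
def projRank (Γ : Submodule F (ι → F)) (S : Finset ι) : ℕ :=
  Module.finrank F (Γ.map (LinearMap.funLeft F F (Subtype.val : {i // i ∈ S} → ι)))

/-- Generalized binomial coefficient `x(x-1)⋯(x-m+1)/m!`. -/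
def genBinom (x : ℚ) (m : ℕ) : ℚ := (descPochhammer ℚ m).eval x / m.factorial

/-- The congruence defining the zeta polynomial of a code. -/
def zetaCongr (q n d : ℕ) (a : ℕ → ℚ) (P : ℚ[X]) : Prop :=
  (X : ℚ[X]) ^ (n - d + 1) ∣
    P * (1 - X) ^ n -
      (1 - Polynomial.C (q : ℚ) * X) * Polynomial.C (((q : ℚ) - 1)⁻¹) *
        ∑ w ∈ Finset.Icc d n, Polynomial.C (a w) * X ^ (w - d) * (1 - X) ^ (n - w)

/-- `P` is the zeta polynomial of a code with parameters `q, n, d` and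
normalized weights `a`. -/
def IsZetaPoly (q n d : ℕ) (a : ℕ → ℚ) (P : ℚ[X]) : Prop :=
  P.natDegree ≤ n - d ∧ zetaCongr q n d a P

set_option linter.unusedSectionVars false

lemma finrank_supportedOn {n : ℕ} (S : Finset (Fin n)) :
    Module.finrank F (supportedOn F S) = S.card := by
  classical
  have e : supportedOn F S ≃ₗ[F] (S → F) :=
    { toFun := fun x i => x.1 i
      map_add' := fun _ _ => rfl
      map_smul' := fun _ _ => rfl
      invFun := fun y => ⟨fun i => if h : i ∈ S then y ⟨i, h⟩ else 0, by
        intro i hi; simp [hi]⟩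
      left_inv := by
        intro x
        ext i
        by_cases h : i ∈ S
        · simp [h]
        · simp [h, x.2 i h]
      right_inv := by
        intro y
        ext i
        simp }
  rw [e.finrank_eq]; simp

lemma finrank_dualCode {n : ℕ} (Γ : Submodule F (Fin n → F)) :
    Module.finrank F (dualCode Γ) + Module.finrank F Γ = n := by
  classical
  let B : LinearMap.BilinForm F (Fin n → F) := Matrix.toBilin' (1 : Matrix (Fin n) (Fin n) F)
  have hB : B.Nondegenerate := by
    apply Matrix.nondegenerate_toBilin'_iff.2
    exact Matrix.nondegenerate_of_det_ne_zero (by simp)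
  have h : dualCode Γ = B.orthogonal Γ := by
    ext x
    simp only [LinearMap.BilinForm.mem_orthogonal_iff, B,
      Matrix.toBilin'_apply', Matrix.one_mulVec]
    change (∀ c ∈ Γ, ∑ i, x i * c i = 0) ↔ ∀ c ∈ Γ, ∑ i, c i * x i = 0
    simp only [mul_comm]
  have h2 := LinearMap.BilinForm.finrank_orthogonal hB Γ
  have h3 := Submodule.finrank_le Γ
  simp only [Module.finrank_fin_fun] at h2 h3
  rw [h, h2]; omega

lemma dual_inf {n : ℕ} (Γ : Submodule F (Fin n → F)) (T : Finset (Fin n)) :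
    dualCode (Γ ⊔ supportedOn F Tᶜ) = dualCode Γ ⊓ supportedOn F T := by
  classical
  ext x
  constructor
  · intro h
    refine ⟨fun c hc => h c (Submodule.mem_sup_left hc), fun i hi => ?_⟩
    have := h (Pi.single i 1) (Submodule.mem_sup_right (by
      intro j hj
      have : j ≠ i := by rintro rfl; simp [hi] at hj
      simp [this]))
    simpa [Pi.single_apply] using this
  · rintro ⟨h1, h2⟩ c hc
    obtain ⟨u, hu, v, hv, rfl⟩ := Submodule.mem_sup.1 hc
    simp only [Pi.add_apply, mul_add, Finset.sum_add_distrib, h1 u hu, zero_add]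
    refine Finset.sum_eq_zero fun i _ => ?_
    by_cases hi : i ∈ T
    · rw [hv i (by simpa using hi), mul_zero]
    · rw [h2 i hi, zero_mul]

lemma card_dual {n : ℕ} (Γ : Submodule F (Fin n → F)) (T : Finset (Fin n)) :
    Nat.card (Γ ⊓ supportedOn F Tᶜ : Submodule F (Fin n → F)) * Fintype.card F ^ T.card =
      Fintype.card F ^ Module.finrank F Γ *
        Nat.card (dualCode Γ ⊓ supportedOn F T : Submodule F (Fin n → F)) := by
  classical
  have h1 := finrank_dualCode (Γ ⊔ supportedOn F Tᶜ)
  rw [dual_inf] at h1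
  have h2 := Submodule.finrank_sup_add_finrank_inf_eq Γ (supportedOn F Tᶜ)
  rw [finrank_supportedOn, Finset.card_compl, Fintype.card_fin] at h2
  have h3 : T.card ≤ n := by simpa using T.card_le_univ
  rw [Nat.card_eq_fintype_card, Nat.card_eq_fintype_card, Module.card_eq_pow_finrank (K := F),
    Module.card_eq_pow_finrank (K := F) (V := (dualCode Γ ⊓ supportedOn F T : Submodule F (Fin n → F))),
    ← pow_add, ← pow_add]
  congr 1
  omega

lemma wt_eq {n : ℕ} [DecidableEq F] (x : Fin n → F) : wt x = #{i | x i ≠ 0} := by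
  rw [wt, Set.ncard_eq_toFinset_card']
  simp

lemma wt_le {n : ℕ} (x : Fin n → F) : wt x ≤ n := by
  classical
  rw [wt_eq]
  simpa using Finset.card_le_univ (α := Fin n) {i | x i ≠ 0}

lemma sum_card {n : ℕ} (Γ : Submodule F (Fin n → F)) (t : ℕ) :
    ∑ T ∈ powersetCard t (univ : Finset (Fin n)),
      Nat.card (Γ ⊓ supportedOn F Tᶜ : Submodule F (Fin n → F)) =
    ∑ w ∈ range (n + 1), wtCount Γ w * (n - w).choose t := by
  classical
  have h1 : ∀ T : Finset (Fin n), Nat.card (Γ ⊓ supportedOn F Tᶜ : Submodule F (Fin n → F)) =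
      ∑ x : Fin n → F with x ∈ Γ, if T ⊆ ({i | x i ≠ 0} : Finset (Fin n))ᶜ then 1 else 0 := by
    intro T
    rw [← Finset.sum_filter, Finset.filter_filter, Finset.sum_const, smul_eq_mul, mul_one,
      Nat.card_eq_fintype_card, Fintype.card_subtype]
    congr 1
    ext x
    simp only [Finset.mem_filter, Finset.mem_univ, true_and, Submodule.mem_inf]
    refine and_congr_right fun _ => ?_
    change (∀ i ∉ Tᶜ, x i = 0) ↔ _
    simp [Finset.subset_iff]
  have h2 : ∀ w, wtCount Γ w = #{x : Fin n → F | x ∈ Γ ∧ wt x = w} := by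
    intro w
    rw [wtCount, Set.ncard_eq_toFinset_card']
    simp
  simp_rw [h1]
  rw [Finset.sum_comm]
  have h3 : ∀ x : Fin n → F, (∑ T ∈ powersetCard t (univ : Finset (Fin n)),
      if T ⊆ ({i | x i ≠ 0} : Finset (Fin n))ᶜ then 1 else 0) = (n - wt x).choose t := by
    intro x
    rw [← Finset.sum_filter, Finset.sum_const, smul_eq_mul, mul_one, wt_eq]
    have hc : n - #{i | x i ≠ 0} = #(({i | x i ≠ 0} : Finset (Fin n))ᶜ) := by
      rw [Finset.card_compl, Fintype.card_fin]
    rw [hc, ← Finset.card_powersetCard]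
    congr 1
    ext T
    simp only [Finset.mem_filter, Finset.mem_powersetCard, Finset.subset_univ, true_and]
    tauto
  simp_rw [h3]
  rw [← Finset.sum_fiberwise_of_maps_to (s := ({x | x ∈ Γ} : Finset (Fin n → F)))
    (t := range (n + 1)) (g := wt) (fun x _ => by simpa [Nat.lt_succ_iff] using wt_le x)]
  refine Finset.sum_congr rfl fun w _ => ?_
  rw [h2, Finset.filter_filter, Finset.sum_congr rfl (g := fun _ => (n - w).choose t), Finset.sum_const,
    smul_eq_mul]
  intro x hx
  simp only [Finset.mem_filter] at hx
  rw [hx.2.2]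

lemma minDist_le {n : ℕ} (Γ : Submodule F (Fin n → F)) (x : Fin n → F) (hx : x ∈ Γ)
    (h0 : x ≠ 0) : minDist Γ ≤ wt x := Nat.sInf_le ⟨x, hx, h0, rfl⟩

lemma minDist_mem {n : ℕ} (Γ : Submodule F (Fin n → F)) (h : 2 ≤ minDist Γ) :
    ∃ x ∈ Γ, x ≠ 0 ∧ wt x = minDist Γ := by
  apply Nat.sInf_mem (s := {w | ∃ x ∈ Γ, x ≠ 0 ∧ wt x = w})
  by_contra hne
  rw [Set.not_nonempty_iff_eq_empty] at hne
  rw [minDist, hne] at h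
  simp at h

lemma wt_zero_iff {n : ℕ} (x : Fin n → F) : wt x = 0 ↔ x = 0 := by
  classical
  rw [wt_eq, Finset.card_eq_zero, Finset.filter_eq_empty_iff]
  simp [funext_iff]

lemma wtCount_zero {n : ℕ} (Γ : Submodule F (Fin n → F)) : wtCount Γ 0 = 1 := by
  rw [wtCount, Set.ncard_eq_one]
  refine ⟨0, ?_⟩
  ext x
  simp only [wt_zero_iff, Set.mem_ofPred_eq, Set.mem_singleton_iff]
  constructor
  · exact fun h => h.2
  · rintro rfl; exact ⟨zero_mem _, rfl⟩

lemma wtCount_lt {n : ℕ} (Γ : Submodule F (Fin n → F)) (w : ℕ) (h0 : 0 < w)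
    (h : w < minDist Γ) : wtCount Γ w = 0 := by
  rw [wtCount, Set.ncard_eq_zero, Set.eq_empty_iff_forall_notMem]
  rintro x ⟨hx, rfl⟩
  have : x ≠ 0 := by rintro rfl; simp [(wt_zero_iff (0 : Fin n → F)).2 rfl] at h0
  exact absurd (minDist_le Γ x hx this) (by omega)

lemma card_supp_lt {n : ℕ} (Γ : Submodule F (Fin n → F)) (T : Finset (Fin n))
    (h : T.card < minDist Γ) :
    Nat.card (Γ ⊓ supportedOn F T : Submodule F (Fin n → F)) = 1 := by
  classical
  have : Γ ⊓ supportedOn F T = ⊥ := by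
    rw [eq_bot_iff]
    rintro x ⟨h1, h2⟩
    by_contra hx
    have h3 := minDist_le Γ x h1 hx
    have : wt x ≤ T.card := by
      rw [wt_eq]
      refine Finset.card_le_card fun i hi => ?_
      by_contra hT
      simp [h2 i hT] at hi
    omega
  rw [this]; simp

lemma sum_supp_gt {n : ℕ} (Γ : Submodule F (Fin n → F)) (h : 2 ≤ minDist Γ) :
    n.choose (minDist Γ) < ∑ T ∈ powersetCard (minDist Γ) (univ : Finset (Fin n)),
      Nat.card (Γ ⊓ supportedOn F T : Submodule F (Fin n → F)) := by
  classical
  obtain ⟨x, hx, h0, hw⟩ := minDist_mem Γ h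
  have : n.choose (minDist Γ) = ∑ T ∈ powersetCard (minDist Γ) (univ : Finset (Fin n)), 1 := by
    simp
  rw [this]
  apply Finset.sum_lt_sum
  · intro T _
    exact Nat.card_pos
  · refine ⟨({i | x i ≠ 0} : Finset (Fin n)), ?_, ?_⟩
    · rw [Finset.mem_powersetCard, ← hw, wt_eq]; simp
    · rw [Finite.one_lt_card_iff_nontrivial]
      refine ⟨⟨x, hx, ?_⟩, 0, ?_⟩
      · intro i hi; simpa using hi
      · intro h; exact h0 (congrArg Subtype.val h)

/-- averaged counts -/
lemma avg_eq {n : ℕ} (Γ : Submodule F (Fin n → F)) (a : ℕ → ℚ)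
    (ha : ∀ w, a w = (wtCount Γ w : ℚ) / (n.choose w)) (t : ℕ) (ht : t ≤ n) :
    (∑ w ∈ range (n + 1), a w * ((n - t).choose w : ℚ)) * n.choose t * (Fintype.card F : ℚ) ^ t =
      (Fintype.card F : ℚ) ^ Module.finrank F Γ * 
      ((∑ T ∈ powersetCard t (univ : Finset (Fin n)),
      Nat.card (dualCode Γ ⊓ supportedOn F T : Submodule F (Fin n → F)) : ℕ) : ℚ) := by
  have h1 := sum_card Γ t
  have h2 : (∑ w ∈ range (n + 1), a w * ((n - t).choose w : ℚ)) * n.choose t =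
      ((∑ w ∈ range (n + 1), wtCount Γ w * (n - w).choose t : ℕ) : ℚ) := by
    push_cast
    rw [Finset.sum_mul]
    refine Finset.sum_congr rfl fun w hw => ?_
    have hw : w ≤ n := by simpa [Nat.lt_succ_iff] using hw
    have hc : (n.choose w : ℚ) ≠ 0 := by exact_mod_cast (Nat.choose_pos hw).ne'
    have key : n.choose t * (n - t).choose w = n.choose w * (n - w).choose t := by
      rcases le_or_gt (t + w) n with h | h
      · have e1 := Nat.choose_mul (n := n) (k := t + w) (s := t) (by omega)
        have e2 := Nat.choose_mul (n := n) (k := t + w) (s := w) (by omega)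
        rw [show t + w - t = w by omega] at e1
        rw [show t + w - w = t by omega] at e2
        rw [← e1, ← e2, Nat.choose_symm_add]
      · rw [Nat.choose_eq_zero_of_lt (by omega : n - t < w),
          Nat.choose_eq_zero_of_lt (by omega : n - w < t), mul_zero, mul_zero]
    have key' : (n.choose t : ℚ) * (n - t).choose w = n.choose w * (n - w).choose t := by
      exact_mod_cast key
    rw [ha]
    field_simp
    linear_combination (wtCount Γ w : ℚ) * key'
  rw [h2, ← h1]
  have h3 : (∑ T ∈ powersetCard t (univ : Finset (Fin n)),
      Nat.card (Γ ⊓ supportedOn F Tᶜ : Submodule F (Fin n → F))) * Fintype.card F ^ t =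
      Fintype.card F ^ Module.finrank F Γ * ∑ T ∈ powersetCard t (univ : Finset (Fin n)),
      Nat.card (dualCode Γ ⊓ supportedOn F T : Submodule F (Fin n → F)) := by
    rw [Finset.sum_mul, Finset.mul_sum]
    refine Finset.sum_congr rfl fun T hT => ?_
    rw [← (Finset.mem_powersetCard.1 hT).2]
    exact card_dual Γ T
  exact_mod_cast h3

lemma choose_series (w : ℕ) :
    (PowerSeries.mk fun s => (s.choose w : ℚ)) * (1 - PowerSeries.X) ^ (w + 1) =
      PowerSeries.X ^ w := by
  have h : (PowerSeries.mk fun s => (s.choose w : ℚ)) =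
      PowerSeries.X ^ w * PowerSeries.mk fun s => ((w + s).choose w : ℚ) := by
    ext s
    rw [PowerSeries.coeff_X_pow_mul', PowerSeries.coeff_mk]
    split_ifs with h
    · rw [PowerSeries.coeff_mk, Nat.add_sub_cancel' h]
    · rw [Nat.choose_eq_zero_of_lt (by omega)]; simp
  rw [h, mul_assoc, PowerSeries.mk_add_choose_mul_one_sub_pow_eq_one, mul_one]

/-- The key coefficient identity. -/
lemma zeta_coeff (q n d : ℕ) (hq : (q : ℚ) - 1 ≠ 0) (hdn : d ≤ n) (a : ℕ → ℚ) (P : ℚ[X])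
    (h : zetaCongr q n d a P) (s : ℕ) (hs : s ≤ n) :
    ((q : ℚ) - 1) * PowerSeries.coeff s (PowerSeries.X ^ d * (P : PowerSeries ℚ)) =
      PowerSeries.coeff s ((1 - PowerSeries.C (q : ℚ) * PowerSeries.X) *
        ((1 - PowerSeries.X) *
        PowerSeries.mk fun s => ∑ w ∈ Icc d n, a w * (s.choose w : ℚ))) := by
  obtain ⟨R, hR⟩ := h
  have hR' := congrArg (fun p : ℚ[X] => (p : PowerSeries ℚ)) hR
  simp only [Polynomial.coe_sub, Polynomial.coe_mul, Polynomial.coe_pow, Polynomial.coe_X,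
    Polynomial.coe_one, Polynomial.coe_C] at hR'
  set Y : PowerSeries ℚ := PowerSeries.X with hY
  set B : PowerSeries ℚ := PowerSeries.mk fun s => ∑ w ∈ Icc d n, a w * (s.choose w : ℚ) with hB
  have hS : Y ^ d * ((∑ w ∈ Icc d n, Polynomial.C (a w) * X ^ (w - d) * (1 - X) ^ (n - w) : ℚ[X])
      : PowerSeries ℚ) = B * (1 - Y) ^ (n + 1) := by
    have hB' : B = ∑ w ∈ Icc d n, PowerSeries.C (a w) *
        PowerSeries.mk fun s => (s.choose w : ℚ) := by
      ext s
      simp [hB]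
    rw [hB', Finset.sum_mul]
    rw [← Polynomial.coeToPowerSeries.ringHom_apply, map_sum, Finset.mul_sum]
    refine Finset.sum_congr rfl fun w hw => ?_
    rw [Finset.mem_Icc] at hw
    rw [Polynomial.coeToPowerSeries.ringHom_apply]
    simp only [Polynomial.coe_sub, Polynomial.coe_mul, Polynomial.coe_pow, Polynomial.coe_X,
      Polynomial.coe_one, Polynomial.coe_C]
    rw [← hY, show n + 1 = (w + 1) + (n - w) by omega, pow_add]
    have e := choose_series w
    rw [← hY] at e
    have e2 : Y ^ w = Y ^ d * Y ^ (w - d) := by rw [← pow_add]; congr 1; omega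
    linear_combination (-PowerSeries.C (a w) * (1 - Y) ^ (n - w)) * e - PowerSeries.C (a w) * (1 - Y) ^ (n - w) * e2
  have hu : (1 - Y) ^ n * PowerSeries.mk 1 ^ n = 1 := by
    rw [← mul_pow, mul_comm, PowerSeries.mk_one_mul_one_sub_eq_one, one_pow]
  have hC : PowerSeries.C ((q : ℚ) - 1) * PowerSeries.C (((q : ℚ) - 1)⁻¹) = 1 := by
    rw [← map_mul, mul_inv_cancel₀ hq, map_one]
  have hX : Y ^ (n + 1) = Y ^ d * Y ^ (n - d + 1) := by rw [← pow_add]; congr 1; omega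
  have main : PowerSeries.C ((q : ℚ) - 1) * (Y ^ d * (P : PowerSeries ℚ)) -
      (1 - PowerSeries.C (q : ℚ) * Y) * ((1 - Y) * B) =
      Y ^ (n + 1) * (PowerSeries.C ((q : ℚ) - 1) * (R : PowerSeries ℚ) * PowerSeries.mk 1 ^ n) := by
    generalize ((∑ w ∈ Icc d n, Polynomial.C (a w) * X ^ (w - d) * (1 - X) ^ (n - w) : ℚ[X])
      : PowerSeries ℚ) = S0 at *
    generalize PowerSeries.C (((q : ℚ) - 1)⁻¹) = ci at *
    generalize PowerSeries.C ((q : ℚ) - 1) = cq at *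
    generalize PowerSeries.C (q : ℚ) = c at *
    generalize (PowerSeries.mk 1 : PowerSeries ℚ) ^ n = U at *
    generalize (P : PowerSeries ℚ) = p at *
    generalize (R : PowerSeries ℚ) = r at *
    rw [hX]
    rw [pow_succ] at hS
    generalize (1 - Y) ^ n = V at *
    linear_combination (cq * Y ^ d * U) * hR' + (1 - c * Y) * U * cq * ci * hS - (cq * Y ^ d * p - (1 - c * Y) * (1 - Y) * B) * hu + (1 - c * Y) * U * V * (1 - Y) * B * hC
  have := congrArg (PowerSeries.coeff s) main
  rw [hY, PowerSeries.coeff_X_pow_mul', if_neg (by omega), ← hY, map_sub, PowerSeries.coeff_C_mul] at this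
  linarith

/-- the zeta polynomial has degree exactly `n + 2 - d - d⊥` and
`P(1) = 1`. -/
theorem stmt_9 {F : Type*} [Field F] [Fintype F] {n : ℕ}
    (Γ : Submodule F (Fin n → F))
    (hk0 : 0 < Module.finrank F Γ) (hkn : Module.finrank F Γ < n)
    (q d d' : ℕ) (hq : q = Fintype.card F)
    (hd : d = minDist Γ) (hd' : d' = minDist (dualCode Γ))
    (hd2 : 2 ≤ d) (hd'2 : 2 ≤ d')
    (a : ℕ → ℚ) (ha : ∀ w, a w = (wtCount Γ w : ℚ) / (n.choose w))
    (P : ℚ[X]) (hP : IsZetaPoly q n d a P) :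
    P.natDegree = n + 2 - d - d' ∧ P.eval 1 = 1 := by

  obtain ⟨hdeg, hcong⟩ := hP
  obtain ⟨x, hx, hx0, hxw⟩ := minDist_mem Γ (by omega)
  have hdn : d ≤ n := by rw [hd, ← hxw]; exact wt_le x
  obtain ⟨y, hy, hy0, hyw⟩ := minDist_mem (dualCode Γ) (by omega)
  have hdn' : d' ≤ n := by rw [hd', ← hyw]; exact wt_le y
  have hQ : (1 : ℚ) < q := by rw [hq]; exact_mod_cast Fintype.one_lt_card
  set Q : ℚ := (q : ℚ) with hQdef
  have hQ0 : Q - 1 ≠ 0 := by linarith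
  set k := Module.finrank F Γ with hk
  let B : ℕ → ℚ := fun s => ∑ w ∈ Icc d n, a w * (s.choose w : ℚ)
  have hBc : ∀ s, ∑ w ∈ range (n + 1), a w * (s.choose w : ℚ) = 1 + B s := by
    intro s
    have hsub : insert 0 (Icc d n) ⊆ range (n + 1) := by
      intro w hw
      simp only [Finset.mem_insert, Finset.mem_Icc, Finset.mem_range] at *
      omega
    rw [← Finset.sum_subset hsub, Finset.sum_insert (by simp; omega)]
    · simp [ha 0, wtCount_zero, B]
    · intro w hw hw'
      simp only [Finset.mem_insert, Finset.mem_Icc, Finset.mem_range] at *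
      rw [ha w, wtCount_lt Γ w (by omega) (by omega)]
      simp
  have hB0 : ∀ s < d, B s = 0 := by
    intro s hs
    refine Finset.sum_eq_zero fun w hw => ?_
    rw [Finset.mem_Icc] at hw
    rw [Nat.choose_eq_zero_of_lt (by omega)]; simp
  have H1 : ∀ t, t < d' → (1 + B (n - t)) * Q ^ t = Q ^ k := by
    intro t ht
    have h := avg_eq Γ a ha t (by omega)
    rw [hBc, ← hq, ← hQdef, Finset.sum_congr rfl (g := fun _ => 1)] at h
    · simp only [Finset.sum_const, Finset.card_powersetCard, Finset.card_univ, Fintype.card_fin,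
        smul_eq_mul, mul_one] at h
      have hc : (n.choose t : ℚ) ≠ 0 := by exact_mod_cast (Nat.choose_pos (by omega)).ne'
      apply mul_right_cancel₀ hc
      linear_combination h
    · intro T hT
      exact card_supp_lt _ T (by rw [(Finset.mem_powersetCard.1 hT).2]; omega)
  have H2 : Q ^ k < (1 + B (n - d')) * Q ^ d' := by
    have h := avg_eq Γ a ha d' (by omega)
    have h2 := sum_supp_gt (dualCode Γ) (by omega)
    rw [← hd'] at h2
    rw [hBc, ← hq, ← hQdef] at h
    have hc : (0 : ℚ) < (n.choose d' : ℚ) := by exact_mod_cast Nat.choose_pos (by omega)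
    have h3 : (n.choose d' : ℚ) < ((∑ T ∈ powersetCard d' (univ : Finset (Fin n)),
      Nat.card (dualCode Γ ⊓ supportedOn F T : Submodule F (Fin n → F)) : ℕ) : ℚ) := by
      exact_mod_cast h2
    have h4 : 0 < Q ^ k := by positivity
    have h5 := mul_lt_mul_of_pos_left h3 h4
    refine lt_of_mul_lt_mul_right ?_ hc.le
    calc Q ^ k * n.choose d' < _ := h5
      _ = _ := by rw [← h]; ring
  obtain ⟨e, rfl⟩ : ∃ e, d = e + 2 := ⟨d - 2, by omega⟩
  have hcoef : ∀ j, e + 2 + j ≤ n → (Q - 1) * P.coeff j =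
      B (e + j + 2) - (Q + 1) * B (e + j + 1) + Q * B (e + j) := by
    intro j hj
    have h := zeta_coeff q n (e + 2) hQ0 hdn a P hcong (e + 2 + j) hj
    rw [PowerSeries.coeff_X_pow_mul', if_pos (by omega), Nat.add_sub_cancel_left,
      Polynomial.coeff_coe, ← hQdef] at h
    rw [h, show e + 2 + j = e + j + 1 + 1 by ring]
    simp only [sub_mul, one_mul, mul_assoc, map_sub, PowerSeries.coeff_C_mul,
      PowerSeries.coeff_succ_X_mul, PowerSeries.coeff_mk, mul_sub]
    simp only [B]
    ring
  have hsum : ∀ m, e + 2 + m ≤ n → (Q - 1) * ∑ j ∈ range (m + 1), P.coeff j =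
      B (e + m + 2) - Q * B (e + m + 1) := by
    intro m
    induction m with
    | zero =>
      intro h
      have h1 := hcoef 0 h
      have h2 := hB0 (e + 0 + 1) (by omega)
      have h3 := hB0 (e + 0) (by omega)
      rw [Finset.sum_range_one, h1, h2, h3]; ring
    | succ m ih =>
      intro h
      rw [Finset.sum_range_succ, mul_add, ih (by omega), hcoef (m + 1) h]
      rw [show e + (m + 1) + 2 = e + m + 3 by ring, show e + (m + 1) + 1 = e + m + 2 by ring,
        show e + (m + 1) = e + m + 1 by ring]
      ring
  have heval : P.eval 1 = 1 := by
    rw [Polynomial.eval_eq_sum_range' (n := n - (e + 2) + 1) (by omega)]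
    simp only [one_pow, mul_one]
    have h := hsum (n - (e + 2)) (by omega)
    have h0 := H1 0 (by omega)
    have h1 := H1 1 (by omega)
    rw [show e + (n - (e + 2)) + 2 = n - 0 by omega,
      show e + (n - (e + 2)) + 1 = n - 1 by omega] at h
    apply mul_left_cancel₀ hQ0
    linear_combination h + h0 - h1
  have hzero : ∀ j, n + 2 < e + 2 + j + d' → P.coeff j = 0 := by
    intro j hj
    by_cases hjn : e + 2 + j ≤ n
    · have h := hcoef j hjn
      obtain ⟨t, ht⟩ : ∃ t, n = e + j + 2 + t := ⟨n - (e + j + 2), by omega⟩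
      have h0 := H1 t (by omega)
      have h1 := H1 (t + 1) (by omega)
      have h2 := H1 (t + 2) (by omega)
      rw [show n - t = e + j + 2 by omega] at h0
      rw [show n - (t + 1) = e + j + 1 by omega] at h1
      rw [show n - (t + 2) = e + j by omega] at h2
      have hQt : Q ^ (t + 2) ≠ 0 := by positivity
      apply mul_left_cancel₀ (mul_ne_zero hQ0 hQt)
      linear_combination Q ^ (t + 2) * h + Q ^ 2 * h0 - Q * (Q + 1) * h1 + Q * h2
    · exact Polynomial.coeff_eq_zero_of_natDegree_lt (by omega)
  have hle : e + 2 + d' ≤ n + 2 := by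
    by_contra hcon
    have hP0 : P = 0 := by
      ext j
      rw [hzero j (by omega), Polynomial.coeff_zero]
    rw [hP0] at heval
    simp at heval
  refine ⟨?_, heval⟩
  apply le_antisymm
  · rw [Polynomial.natDegree_le_iff_coeff_eq_zero]
    intro j hj
    exact hzero j (by omega)
  · apply Polynomial.le_natDegree_of_ne_zero
    intro hz
    obtain ⟨j, hj⟩ : ∃ j, j = n + 2 - (e + 2) - d' := ⟨_, rfl⟩
    rw [← hj] at hz
    obtain ⟨t, ht⟩ : ∃ t, d' = t + 2 := ⟨d' - 2, by omega⟩
    have h := hcoef j (by omega)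
    have h0 := H1 t (by omega)
    have h1 := H1 (t + 1) (by omega)
    rw [ht] at H2
    rw [show n - t = e + j + 2 by omega] at h0
    rw [show n - (t + 1) = e + j + 1 by omega] at h1
    rw [show n - (t + 2) = e + j by omega] at H2
    rw [hz] at h
    have h5 : Q * ((1 + B (e + j)) * Q ^ (t + 2)) = Q * Q ^ k := by
      linear_combination -Q ^ (t + 2) * h - Q ^ 2 * h0 + Q * (Q + 1) * h1
    have h6 := mul_lt_mul_of_pos_left H2 (by linarith : (0 : ℚ) < Q)
    linarith

end
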